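/- arXiv:2106.13781 — 4 statements merged into one kernel-verified Lean document; each statement's English description precedes it below -/
import Mathlib

section
/- Let f, g : ℝ^d × ℝ^{d'} → ℝ with f continuously differentiable and g twice continuously differentiable, and suppose that for every x ∈ ℝ^d the function y ↦ g(x,y) is μ_g-strongly convex for some μ_g > 0, with unique minimizer y*(x). Then F(x) := f(x, y*(x)) is differentiable on ℝ^d and its gradient satisfies ∇F(x) = ∇_x f(x, y*(x)) − ∇²_{xy} g(x, y*(x)) · [∇²_{yy} g(x, y*(x))]⁻¹ · ∇_y f(x, y*(x)) for every x. -/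
open scoped InnerProductSpace

noncomputable section

/-- ℝ^d with the Euclidean norm. -/
abbrev Euc (d : ℕ) := EuclideanSpace ℝ (Fin d)

/-- First-order lower bound for strongly convex functions. -/
theorem strong_first_order {n : ℕ} {h : Euc n → ℝ} {m : ℝ}
    (hs : StrongConvexOn Set.univ m h) {p y : Euc n} (hp : HasGradientAt h p y) (z : Euc n) :
    h y + ⟪p, z - y⟫_ℝ + m / 2 * ‖z - y‖ ^ 2 ≤ h z := by
  have hc := strongConvexOn_iff_convex.1 hs
  have hk := hc.comp_affineMap (AffineMap.lineMap y z : ℝ →ᵃ[ℝ] Euc n)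
  have hl : HasDerivAt (AffineMap.lineMap y z : ℝ → Euc n) (z - y) 0 :=
    AffineMap.hasDerivAt_lineMap
  have h1 : HasDerivAt (fun t : ℝ => h (AffineMap.lineMap y z t)) ⟪p, z - y⟫_ℝ 0 := by
    have hp' : HasFDerivAt h (InnerProductSpace.toDual ℝ _ p)
        ((AffineMap.lineMap y z : ℝ → Euc n) 0) := by
      simpa using hp.hasFDerivAt
    simpa using! hp'.comp_hasDerivAt (0 : ℝ) hl
  have h2 : HasDerivAt (fun t : ℝ => ‖(AffineMap.lineMap y z t : Euc n)‖ ^ 2)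
      (2 * ⟪y, z - y⟫_ℝ) 0 := by
    simpa using hl.norm_sq
  have h3 := h1.sub (h2.const_mul (m / 2))
  have h4 := hk.le_slope_of_hasDerivAt (x := 0) (y := 1) (by simp) (by simp) one_pos h3
  simp [slope_def_field] at h4
  have h5 : ‖z‖ ^ 2 = ‖y‖ ^ 2 + 2 * ⟪y, z - y⟫_ℝ + ‖z - y‖ ^ 2 := by
    rw [← norm_add_sq_real]; simp
  rw [h5] at h4
  linarith

theorem strong_monotone {n : ℕ} {h : Euc n → ℝ} {m : ℝ}
    (hs : StrongConvexOn Set.univ m h) {p q y z : Euc n} (hp : HasGradientAt h p y)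
    (hq : HasGradientAt h q z) :
    m * ‖z - y‖ ^ 2 ≤ ⟪q - p, z - y⟫_ℝ := by
  have h1 := strong_first_order hs hp z
  have h2 := strong_first_order hs hq y
  rw [norm_sub_rev, ← neg_sub z y, inner_neg_right] at h2
  rw [inner_sub_left]
  linarith

theorem coercive_of_monotone {n : ℕ} {G : Euc n → Euc n} {m : ℝ}
    (hG : ∀ y z, m * ‖z - y‖ ^ 2 ≤ ⟪G z - G y, z - y⟫_ℝ) {B : Euc n →L[ℝ] Euc n} {y : Euc n}
    (hB : HasFDerivAt G B y) (v : Euc n) : m * ‖v‖ ^ 2 ≤ ⟪B v, v⟫_ℝ := by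
  have hl : HasDerivAt (fun t : ℝ => y + t • v) v 0 := by
    simpa using ((hasDerivAt_id (0 : ℝ)).smul_const v).const_add y
  have hB' : HasFDerivAt G B (y + (0 : ℝ) • v) := by simpa using hB
  have h1 := hB'.comp_hasDerivAt (0 : ℝ) hl
  have h2 := (hasDerivAt_iff_tendsto_slope.1 h1)
  have h3 : Filter.Tendsto (fun t => ⟪slope (G ∘ fun t : ℝ => y + t • v) 0 t, v⟫_ℝ)
      (nhdsWithin 0 {0}ᶜ) (nhds ⟪B v, v⟫_ℝ) := h2.inner tendsto_const_nhds
  refine ge_of_tendsto h3 ?_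
  filter_upwards [self_mem_nhdsWithin] with t ht
  have ht : t ≠ 0 := ht
  have h4 := hG y (y + t • v)
  simp only [add_sub_cancel_left, norm_smul, inner_smul_right, mul_pow, Real.norm_eq_abs,
    sq_abs] at h4
  simp only [slope_def_module, Function.comp, inner_smul_left, sub_zero, zero_smul, add_zero]
  have h5 : 0 < t ^ 2 := by positivity
  simp only [conj_trivial]
  rw [← mul_le_mul_iff_right₀ h5]
  calc t ^ 2 * (m * ‖v‖ ^ 2) = m * (t ^ 2 * ‖v‖ ^ 2) := by ring
    _ ≤ _ := h4
    _ = _ := by field_simp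

theorem isInvertible_of_coercive {n : ℕ} {B : Euc n →L[ℝ] Euc n} {m : ℝ} (hm : 0 < m)
    (hB : ∀ v, m * ‖v‖ ^ 2 ≤ ⟪B v, v⟫_ℝ) : B.IsInvertible := by
  have hinj : Function.Injective B.toLinearMap := by
    rw [injective_iff_map_eq_zero]
    intro v hv
    have := hB v
    have hv' : B v = 0 := hv
    rw [hv', inner_zero_left] at this
    by_contra hne
    have : 0 < ‖v‖ := norm_pos_iff.2 hne
    have : 0 < m * ‖v‖ ^ 2 := by positivity
    linarith
  refine ⟨(LinearEquiv.ofInjectiveEndo B.toLinearMap hinj).toContinuousLinearEquiv, ?_⟩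
  ext v
  rfl

theorem bilevel_gradient_formula {d d' : ℕ}
    (f g : Euc d × Euc d' → ℝ)
    (hf : ContDiff ℝ 1 f) (hg : ContDiff ℝ 2 g)
    (μg : ℝ) (hμg : 0 < μg)
    (hstrong : ∀ x : Euc d, StrongConvexOn Set.univ μg (fun y : Euc d' => g (x, y)))
    (ystar : Euc d → Euc d')
    (hmin : ∀ (x : Euc d) (y : Euc d'), g (x, ystar x) ≤ g (x, y))
    (huniq : ∀ (x : Euc d) (y : Euc d'), (∀ y' : Euc d', g (x, y) ≤ g (x, y')) → y = ystar x) :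
    ∀ x : Euc d,
      HasGradientAt (fun x' : Euc d => f (x', ystar x'))
        (gradient (fun x' : Euc d => f (x', ystar x)) x
          - (ContinuousLinearMap.adjoint
              (fderiv ℝ (fun x' : Euc d => gradient (fun y : Euc d' => g (x', y)) (ystar x)) x))
            ((Ring.inverse
                (fderiv ℝ (fun y' : Euc d' => gradient (fun y : Euc d' => g (x, y)) y') (ystar x)))
              (gradient (fun y : Euc d' => f (x, y)) (ystar x)))) x := by
  intro x
  -- the partial gradient of `g` in `y`
  let G : Euc d × Euc d' → Euc d' := fun u => gradient (fun y : Euc d' => g (u.1, y)) u.2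
  have hgd : Differentiable ℝ g := hg.differentiable (by norm_num)
  have hfd : Differentiable ℝ f := hf.differentiable (by norm_num)
  have hr : ∀ (x : Euc d) (y : Euc d'), HasFDerivAt (fun y : Euc d' => (x, y))
      (.inr ℝ (Euc d) (Euc d')) y := fun x y => hasFDerivAt_prodMk_right x y
  have hl : ∀ (x : Euc d) (y : Euc d'), HasFDerivAt (fun x : Euc d => (x, y))
      (.inl ℝ (Euc d) (Euc d')) x := fun x y => hasFDerivAt_prodMk_left x y
  have hgy : ∀ x y, HasFDerivAt (fun y : Euc d' => g (x, y))
      ((fderiv ℝ g (x, y)).comp (.inr ℝ (Euc d) (Euc d'))) y := fun x y =>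
    (hgd (x, y)).hasFDerivAt.comp y (hr x y)
  have hGgrad : ∀ x y, HasGradientAt (fun y : Euc d' => g (x, y)) (G (x, y)) y := fun x y =>
    (hgy x y).differentiableAt.hasGradientAt
  have hGeq : G = fun u => (InnerProductSpace.toDual ℝ (Euc d')).symm
      ((fderiv ℝ g u).comp (.inr ℝ (Euc d) (Euc d'))) := by
    funext u
    change (InnerProductSpace.toDual ℝ (Euc d')).symm _ = _
    rw [(hgy u.1 u.2).fderiv]
  have hGC : ContDiff ℝ 1 G := by
    rw [hGeq]
    have h1 : ContDiff ℝ 1 (fderiv ℝ g) := hg.fderiv_right (by norm_num)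
    exact (InnerProductSpace.toDual ℝ (Euc d')).symm.contDiff.comp
      (h1.clm_comp contDiff_const)
  have hmono : ∀ x y z, μg * ‖z - y‖ ^ 2 ≤ ⟪G (x, z) - G (x, y), z - y⟫_ℝ := fun x y z =>
    strong_monotone (hstrong x) (hGgrad x y) (hGgrad x z)
  have hG0 : ∀ x, G (x, ystar x) = 0 := by
    intro x
    have : IsLocalMin (fun y : Euc d' => g (x, y)) (ystar x) :=
      Filter.Eventually.of_forall (hmin x)
    have h0 := this.fderiv_eq_zero
    change (InnerProductSpace.toDual ℝ (Euc d')).symm (fderiv ℝ (fun y : Euc d' => g (x, y)) (ystar x)) = 0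
    rw [h0, map_zero]
  have hGs : HasStrictFDerivAt G (fderiv ℝ G (x, ystar x)) (x, ystar x) :=
    hGC.contDiffAt.hasStrictFDerivAt (by norm_num)
  set G' := fderiv ℝ G (x, ystar x) with hG'
  have hB : HasFDerivAt (fun y => G (x, y)) (G' ∘L .inr ℝ (Euc d) (Euc d')) (ystar x) :=
    hGs.hasFDerivAt.comp (ystar x) (hr x (ystar x))
  have hA : HasFDerivAt (fun x' => G (x', ystar x)) (G' ∘L .inl ℝ (Euc d) (Euc d')) x :=
    HasFDerivAt.comp (g := G) x hGs.hasFDerivAt (hl x (ystar x))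
  have hcoer := coercive_of_monotone (hmono x) hB
  have hinv := isInvertible_of_coercive hμg hcoer
  -- implicit function theorem
  have hψ := (hGs.hasStrictFDerivAt_implicitFunctionOfProdDomain hinv).hasFDerivAt
  have hev := hGs.eventually_apply_implicitFunctionOfProdDomain hinv
  have hy : HasFDerivAt ystar (-(G' ∘L .inr ℝ (Euc d) (Euc d')).inverse ∘L
      (G' ∘L .inl ℝ (Euc d) (Euc d'))) x := by
    refine hψ.congr_of_eventuallyEq ?_
    filter_upwards [hev] with x' hx'
    rw [hG0 x] at hx'
    have h1 := hmono x' (ystar x') (hGs.implicitFunctionOfProdDomain hinv x')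
    rw [hx', hG0, sub_zero, inner_zero_left] at h1
    by_contra hne
    have : 0 < ‖hGs.implicitFunctionOfProdDomain hinv x' - ystar x'‖ :=
      norm_pos_iff.2 (sub_ne_zero.2 (Ne.symm hne))
    have : 0 < μg * ‖hGs.implicitFunctionOfProdDomain hinv x' - ystar x'‖ ^ 2 := by positivity
    linarith
  have hF := (hfd (x, ystar x)).hasFDerivAt.comp x ((hasFDerivAt_id x).prodMk hy)
  have hfx : HasFDerivAt (fun x' => f (x', ystar x))
      ((fderiv ℝ f (x, ystar x)).comp (.inl ℝ (Euc d) (Euc d'))) x :=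
    (hfd (x, ystar x)).hasFDerivAt.comp x (hl x (ystar x))
  have hfy : HasFDerivAt (fun y => f (x, y))
      ((fderiv ℝ f (x, ystar x)).comp (.inr ℝ (Euc d) (Euc d'))) (ystar x) :=
    (hfd (x, ystar x)).hasFDerivAt.comp (ystar x) (hr x (ystar x))
  rw [hA.fderiv, hB.fderiv, ContinuousLinearMap.ringInverse_eq_inverse]
  rw [hasGradientAt_iff_hasFDerivAt]
  refine hF.congr_fderiv ?_
  -- the Hessian in `y` is symmetric
  have hsymm : ∀ v w, ⟪(G' ∘L .inr ℝ (Euc d) (Euc d')) v, w⟫_ℝ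
      = ⟪v, (G' ∘L .inr ℝ (Euc d) (Euc d')) w⟫_ℝ := by
    intro v w
    let T : Euc d' →L[ℝ] (Euc d' →L[ℝ] ℝ) :=
      LinearMap.toContinuousLinearMap
        { toFun := fun a => InnerProductSpace.toDual ℝ (Euc d') a
          map_add' := fun a b => map_add _ a b
          map_smul' := fun c a => by ext; simp [inner_smul_left] }
    have h1 : HasFDerivAt (fun y => T (G (x, y))) (T ∘L (G' ∘L .inr ℝ (Euc d) (Euc d')))
        (ystar x) := T.hasFDerivAt.comp (ystar x) hB
    have h2 := second_derivative_symmetric (f := fun y => g (x, y))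
      (f' := fun y => T (G (x, y)))
      (fun y => (hGgrad x y).hasFDerivAt) h1 v w
    rw [real_inner_comm _ v]
    exact h2
  have hadj : ∀ c a, ⟪(G' ∘L .inr ℝ (Euc d) (Euc d')).inverse c, a⟫_ℝ
      = ⟪c, (G' ∘L .inr ℝ (Euc d) (Euc d')).inverse a⟫_ℝ := by
    intro c a
    have h1 := hsymm ((G' ∘L .inr ℝ (Euc d) (Euc d')).inverse c)
      ((G' ∘L .inr ℝ (Euc d) (Euc d')).inverse a)
    rw [hinv.self_apply_inverse, hinv.self_apply_inverse] at h1
    exact h1.symm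
  have hgx : ∀ v, ⟪gradient (fun x' => f (x', ystar x)) x, v⟫_ℝ
      = fderiv ℝ f (x, ystar x) (v, 0) := by
    intro v
    rw [gradient, InnerProductSpace.toDual_symm_apply, hfx.fderiv]
    rfl
  have hgy' : ∀ v, ⟪gradient (fun y => f (x, y)) (ystar x), v⟫_ℝ
      = fderiv ℝ f (x, ystar x) (0, v) := by
    intro v
    rw [gradient, InnerProductSpace.toDual_symm_apply, hfy.fderiv]
    rfl
  ext1 v
  rw [InnerProductSpace.toDual_apply_apply, inner_sub_left, ContinuousLinearMap.adjoint_inner_left,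
    hadj, hgx, hgy', ← map_sub]
  simp
end
end

section
/- Let g : ℝ^d × ℝ^{d'} → ℝ be differentiable with ∇g being ℓ_{g,1}-Lipschitz continuous on ℝ^d × ℝ^{d'}, and suppose that for every x ∈ ℝ^d the function y ↦ g(x,y) is μ_g-strongly convex for some μ_g > 0, with unique minimizer y*(x). Then the map y* is (ℓ_{g,1}/μ_g)-Lipschitz continuous: ‖y*(x₁) − y*(x₂)‖ ≤ (ℓ_{g,1}/μ_g) ‖x₁ − x₂‖ for all x₁, x₂ ∈ ℝ^d. -/
open scoped InnerProductSpace

noncomputable section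

/-- The pair `(x, y)` viewed as an element of `ℝ^d × ℝ^{d'}` equipped with the
Euclidean (ℓ²-product) norm. -/
def prodPt {d d' : ℕ} (x : Euc d) (y : Euc d') : WithLp 2 (Euc d × Euc d') :=
  (WithLp.equiv 2 (Euc d × Euc d')).symm (x, y)

theorem prodPt_grad_inner {d d' : ℕ} (g : WithLp 2 (Euc d × Euc d') → ℝ)
    (hdiff : Differentiable ℝ g) (x : Euc d) (y v : Euc d') :
    ⟪gradient (fun y : Euc d' => g (prodPt x y)) y, v⟫_ℝ
      = ⟪gradient g (prodPt x y), prodPt 0 v⟫_ℝ := by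
  let L : Euc d' →L[ℝ] WithLp 2 (Euc d × Euc d') :=
    (WithLp.prodContinuousLinearEquiv 2 ℝ (Euc d) (Euc d')).symm.toContinuousLinearMap.comp
      (ContinuousLinearMap.inr ℝ (Euc d) (Euc d'))
  have hL : ∀ w, L w = prodPt 0 w := fun w => rfl
  have hp : (fun y : Euc d' => prodPt x y) = fun y => prodPt x 0 + L y := by
    funext w
    rw [hL]
    apply (WithLp.equiv 2 (Euc d × Euc d')).injective
    change (x, w) = (x, (0 : Euc d')) + ((0 : Euc d), w)
    simp
  have hd : HasFDerivAt (fun y : Euc d' => prodPt x y) L y := by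
    rw [hp]
    exact L.hasFDerivAt.const_add _
  have hg : HasFDerivAt (fun y : Euc d' => g (prodPt x y))
      ((fderiv ℝ g (prodPt x y)).comp L) y :=
    HasFDerivAt.comp y (hdiff (prodPt x y)).hasFDerivAt hd
  unfold gradient
  rw [InnerProductSpace.toDual_symm_apply, InnerProductSpace.toDual_symm_apply, hg.fderiv]
  rfl

theorem prodPt_norm_right {d d' : ℕ} (v : Euc d') :
    ‖(prodPt 0 v : WithLp 2 (Euc d × Euc d'))‖ = ‖v‖ :=
  WithLp.norm_toLp_snd 2 (Euc d) (Euc d') v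

theorem prodPt_norm_sub {d d' : ℕ} (x₁ x₂ : Euc d) (y : Euc d') :
    ‖prodPt x₁ y - prodPt x₂ y‖ = ‖x₁ - x₂‖ := by
  have : prodPt x₁ y - prodPt x₂ y = WithLp.toLp 2 (x₁ - x₂, (0 : Euc d')) := by
    apply (WithLp.equiv 2 (Euc d × Euc d')).injective
    change (x₁, y) - (x₂, y) = (x₁ - x₂, (0 : Euc d'))
    simp
  rw [this]
  exact WithLp.norm_toLp_fst 2 (Euc d) (Euc d') _

theorem lower_level_solution_lipschitz {d d' : ℕ}
    (g : WithLp 2 (Euc d × Euc d') → ℝ)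
    (hdiff : Differentiable ℝ g)
    (ℓg1 : ℝ)
    (hgradLip : ∀ p q : WithLp 2 (Euc d × Euc d'),
      ‖gradient g p - gradient g q‖ ≤ ℓg1 * ‖p - q‖)
    (μg : ℝ) (hμg : 0 < μg)
    (hstrong : ∀ (x : Euc d) (y₁ y₂ : Euc d'),
      ⟪gradient (fun y : Euc d' => g (prodPt x y)) y₁
          - gradient (fun y : Euc d' => g (prodPt x y)) y₂, y₁ - y₂⟫_ℝ
        ≥ μg * ‖y₁ - y₂‖ ^ 2)
    (ystar : Euc d → Euc d')
    (hmin : ∀ (x : Euc d) (y : Euc d'), g (prodPt x (ystar x)) ≤ g (prodPt x y))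
    (huniq : ∀ (x : Euc d) (y : Euc d'),
      (∀ y' : Euc d', g (prodPt x y) ≤ g (prodPt x y')) → y = ystar x) :
    ∀ x₁ x₂ : Euc d, ‖ystar x₁ - ystar x₂‖ ≤ (ℓg1 / μg) * ‖x₁ - x₂‖ := by
  intro x₁ x₂
  have hz : ∀ x, gradient (fun y : Euc d' => g (prodPt x y)) (ystar x) = 0 := by
    intro x
    have : IsLocalMin (fun y : Euc d' => g (prodPt x y)) (ystar x) :=
      Filter.Eventually.of_forall (hmin x)
    unfold gradient
    rw [this.fderiv_eq_zero, map_zero]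
  have h1 := hstrong x₁ (ystar x₁) (ystar x₂)
  set v := ystar x₁ - ystar x₂ with hv
  have h2 : ⟪gradient (fun y : Euc d' => g (prodPt x₁ y)) (ystar x₁)
          - gradient (fun y : Euc d' => g (prodPt x₁ y)) (ystar x₂), v⟫_ℝ
      = ⟪gradient g (prodPt x₂ (ystar x₂)) - gradient g (prodPt x₁ (ystar x₂)),
          prodPt 0 v⟫_ℝ := by
    rw [inner_sub_left, inner_sub_left, ← prodPt_grad_inner g hdiff,
      ← prodPt_grad_inner g hdiff, hz, hz]
  have h3 := real_inner_le_norm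
    (gradient g (prodPt x₂ (ystar x₂)) - gradient g (prodPt x₁ (ystar x₂))) (prodPt 0 v)
  have h4 := hgradLip (prodPt x₂ (ystar x₂)) (prodPt x₁ (ystar x₂))
  rw [prodPt_norm_sub, norm_sub_rev x₂ x₁] at h4
  rw [prodPt_norm_right] at h3
  have h5 := mul_le_mul_of_nonneg_right h4 (norm_nonneg v)
  have h6 : μg * ‖v‖ ^ 2 ≤ ℓg1 * ‖x₁ - x₂‖ * ‖v‖ := by linarith
  have h0 : 0 ≤ ℓg1 * ‖x₁ - x₂‖ := (norm_nonneg _).trans h4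
  rw [div_mul_eq_mul_div, le_div_iff₀ hμg]
  rcases (norm_nonneg v).eq_or_lt with h | h
  · rw [← h]; simpa using h0
  · nlinarith
end
end

section
/- Let g : ℝ^d × ℝ^{d'} → ℝ be twice continuously differentiable with ∇g being ℓ_{g,1}-Lipschitz continuous and ∇²g being ℓ_{g,2}-Lipschitz continuous (in the Frobenius norm) on ℝ^d × ℝ^{d'}, and suppose that for every x ∈ ℝ^d the function y ↦ g(x,y) is μ_g-strongly convex for some μ_g > 0, with unique minimizer y*(x). Set L_y := ℓ_{g,1}/μ_g. Then the Jacobian map x ↦ ∇_x y*(x) is Lipschitz continuous with constant L_{yx} := (ℓ_{g,2} + ℓ_{g,2} L_y)/μ_g + ℓ_{g,1}(ℓ_{g,2} + ℓ_{g,2} L_y)/μ_g², i.e., ‖∇_x y*(x₁) − ∇_x y*(x₂)‖ ≤ L_{yx} ‖x₁ − x₂‖ for all x₁, x₂ ∈ ℝ^d. -/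
open scoped InnerProductSpace

noncomputable section

section helpers

variable {d d' : ℕ}

lemma comp_line {E F K : Type*} [NormedAddCommGroup E] [NormedSpace ℝ E] [NormedAddCommGroup F]
    [NormedSpace ℝ F] [NormedAddCommGroup K] [NormedSpace ℝ K]
    (G : E → F) (L : E →L[ℝ] F) (I : K →L[ℝ] E) (c : E) (y w : K) (t : ℝ)
    (hG : HasFDerivAt G L (c + I (y + t • w))) :
    HasDerivAt (fun s : ℝ => G (c + I (y + s • w))) (L (I w)) t := by
  have h1 : HasDerivAt (fun t : ℝ => y + t • w) w t := by
    simpa using ((hasDerivAt_id t).smul_const w).const_add y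
  have h2 : HasDerivAt (fun t : ℝ => c + I (y + t • w)) (I w) t :=
    (I.hasFDerivAt.comp_hasDerivAt t h1).const_add c
  exact hG.comp_hasDerivAt t h2

lemma prodPt_fst (x : Euc d) (y : Euc d') : (prodPt x y).fst = x := rfl
lemma prodPt_snd (x : Euc d) (y : Euc d') : (prodPt x y).snd = y := rfl

lemma prodPt_add (x x' : Euc d) (y y' : Euc d') :
    prodPt (x + x') (y + y') = prodPt x y + prodPt x' y' := rfl
lemma prodPt_sub (x x' : Euc d) (y y' : Euc d') :
    prodPt (x - x') (y - y') = prodPt x y - prodPt x' y' := rfl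
lemma prodPt_smul (t : ℝ) (x : Euc d) (y : Euc d') :
    prodPt (t • x) (t • y) = t • prodPt x y := rfl

lemma norm_prodPt_sq (x : Euc d) (y : Euc d') :
    ‖prodPt x y‖ ^ 2 = ‖x‖ ^ 2 + ‖y‖ ^ 2 := by
  rw [WithLp.prod_norm_sq_eq_of_L2]; rfl

lemma norm_prodPt_zero_left (y : Euc d') : ‖prodPt (0 : Euc d) y‖ = ‖y‖ := by
  have := norm_prodPt_sq (0 : Euc d) y
  simp only [norm_zero] at this
  exact (sq_eq_sq₀ (norm_nonneg _) (norm_nonneg _)).1 (by linarith)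

lemma norm_prodPt_zero_right (x : Euc d) : ‖prodPt x (0 : Euc d')‖ = ‖x‖ := by
  have := norm_prodPt_sq x (0 : Euc d')
  simp only [norm_zero] at this
  exact (sq_eq_sq₀ (norm_nonneg _) (norm_nonneg _)).1 (by linarith)

lemma norm_prodPt_le (x : Euc d) (y : Euc d') : ‖prodPt x y‖ ≤ ‖x‖ + ‖y‖ := by
  have h : prodPt x y = prodPt x 0 + prodPt 0 y := by
    rw [← prodPt_add]; simp
  rw [h]
  refine (norm_add_le _ _).trans ?_
  rw [norm_prodPt_zero_left, norm_prodPt_zero_right]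

lemma norm_wsnd_le (p : WithLp 2 (Euc d × Euc d')) : ‖p.snd‖ ≤ ‖p‖ := by
  have h := WithLp.prod_norm_sq_eq_of_L2 p
  exact le_of_sq_le_sq₀' p h
where
  le_of_sq_le_sq₀' (p : WithLp 2 (Euc d × Euc d'))
      (h : ‖p‖ ^ 2 = ‖p.fst‖ ^ 2 + ‖p.snd‖ ^ 2) : ‖p.snd‖ ≤ ‖p‖ := by
    apply le_of_sq_le_sq _ (norm_nonneg _)
    nlinarith [sq_nonneg ‖p.fst‖]
  le_of_sq_le_sq {a b : ℝ} (h : a ^ 2 ≤ b ^ 2) (hb : 0 ≤ b) : a ≤ b :=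
    (le_abs_self a).trans (abs_le_of_sq_le_sq h hb)

/-- second projection as a continuous linear map -/
def sndL (d d' : ℕ) : WithLp 2 (Euc d × Euc d') →L[ℝ] Euc d' :=
  LinearMap.mkContinuous
    { toFun := fun p => p.snd, map_add' := fun _ _ => rfl, map_smul' := fun _ _ => rfl } 1
    (fun p => by rw [one_mul]; exact norm_wsnd_le p)

/-- left inclusion as a continuous linear map -/
def inlL (d d' : ℕ) : Euc d →L[ℝ] WithLp 2 (Euc d × Euc d') :=
  LinearMap.mkContinuous
    { toFun := fun x => prodPt x 0,
      map_add' := fun x y => by rw [← prodPt_add, add_zero]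
      map_smul' := fun t x => by rw [RingHom.id_apply, ← prodPt_smul, smul_zero] } 1
    (fun p => by rw [one_mul]; exact (norm_prodPt_zero_right p).le)

/-- right inclusion as a continuous linear map -/
def inrL (d d' : ℕ) : Euc d' →L[ℝ] WithLp 2 (Euc d × Euc d') :=
  LinearMap.mkContinuous
    { toFun := fun x => prodPt 0 x,
      map_add' := fun x y => by rw [← prodPt_add, add_zero]
      map_smul' := fun t x => by rw [RingHom.id_apply, ← prodPt_smul, smul_zero] } 1
    (fun p => by rw [one_mul]; exact (norm_prodPt_zero_left p).le)

lemma sndL_apply (p : WithLp 2 (Euc d × Euc d')) : sndL d d' p = p.snd := rfl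
lemma inlL_apply (x : Euc d) : inlL d d' x = prodPt x 0 := rfl
lemma inrL_apply (x : Euc d') : inrL d d' x = prodPt 0 x := rfl

lemma prodPt_eq (x : Euc d) (z : Euc d') : prodPt x z = prodPt x 0 + inrL d d' z := by
  rw [inrL_apply, ← prodPt_add, add_zero, zero_add]

lemma line_hasDerivAt {F : Type*} [NormedAddCommGroup F] [NormedSpace ℝ F]
    (G : WithLp 2 (Euc d × Euc d') → F) (L : WithLp 2 (Euc d × Euc d') →L[ℝ] F)
    (x : Euc d) (y w : Euc d') (t : ℝ) (hG : HasFDerivAt G L (prodPt x (y + t • w))) :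
    HasDerivAt (fun t : ℝ => G (prodPt x (y + t • w))) (L (prodPt 0 w)) t := by
  rw [prodPt_eq] at hG
  have h := comp_line G L (inrL d d') (prodPt x 0) y w t hG
  simp only [← prodPt_eq] at h
  exact h

lemma line_deriv (g : WithLp 2 (Euc d × Euc d') → ℝ) (hg : Differentiable ℝ g)
    (x : Euc d) (y w : Euc d') (t : ℝ) :
    HasDerivAt (fun t : ℝ => g (prodPt x (y + t • w)))
      (⟪(gradient g (prodPt x (y + t • w))).snd, w⟫_ℝ) t := by
  have h2 := line_hasDerivAt g _ x y w t (hg (prodPt x (y + t • w))).hasGradientAt.hasFDerivAt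
  refine h2.congr_deriv ?_
  rw [InnerProductSpace.toDual_apply_apply, WithLp.prod_inner_apply]
  change ⟪_, (0 : Euc d)⟫_ℝ + ⟪_, w⟫_ℝ = _
  rw [inner_zero_right, zero_add]; rfl

lemma strong_mono (g : WithLp 2 (Euc d × Euc d') → ℝ) (hg : Differentiable ℝ g)
    (μg : ℝ) (x : Euc d)
    (hs : StrongConvexOn Set.univ μg (fun y : Euc d' => g (prodPt x y))) (y w : Euc d') :
    μg * ‖w‖ ^ 2 ≤
      ⟪(gradient g (prodPt x (y + w))).snd - (gradient g (prodPt x y)).snd, w⟫_ℝ := by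
  rw [strongConvexOn_iff_convex] at hs
  have hc : ConvexOn ℝ Set.univ
      (fun t : ℝ => g (prodPt x (y + t • w)) - μg / 2 * ‖y + t • w‖ ^ 2) := by
    have := hs.comp_affineMap (AffineMap.lineMap y (y + w))
    have e : (fun t : ℝ => g (prodPt x (y + t • w)) - μg / 2 * ‖y + t • w‖ ^ 2)
        = (fun x_1 => g (prodPt x x_1) - μg / 2 * ‖x_1‖ ^ 2)
          ∘ (AffineMap.lineMap y (y + w)) := by
      funext t
      simp [AffineMap.lineMap_apply, add_comm]
    rw [e]
    exact this
  have hd : ∀ t : ℝ, HasDerivAt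
      (fun t : ℝ => g (prodPt x (y + t • w)) - μg / 2 * ‖y + t • w‖ ^ 2)
      (⟪(gradient g (prodPt x (y + t • w))).snd, w⟫_ℝ - μg * ⟪y + t • w, w⟫_ℝ) t := by
    intro t
    have h1 : HasDerivAt (fun t : ℝ => y + t • w) w t := by
      simpa using ((hasDerivAt_id t).smul_const w).const_add y
    have h2 := (h1.norm_sq).const_mul (μg / 2)
    refine ((line_deriv g hg x y w t).sub h2).congr_deriv ?_
    ring
  have a := hc.le_slope_of_hasDerivAt (Set.mem_univ 0) (Set.mem_univ 1) zero_lt_one (hd 0)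
  have b := hc.slope_le_of_hasDerivAt (Set.mem_univ 0) (Set.mem_univ 1) zero_lt_one (hd 1)
  have c := a.trans b
  simp only [zero_smul, add_zero, one_smul, inner_add_left, real_inner_self_eq_norm_sq] at c
  rw [inner_sub_left]
  linarith

lemma strong_mono_norm (g : WithLp 2 (Euc d × Euc d') → ℝ) (hg : Differentiable ℝ g)
    (μg : ℝ) (x : Euc d)
    (hs : StrongConvexOn Set.univ μg (fun y : Euc d' => g (prodPt x y))) (y w : Euc d') :
    μg * ‖w‖ ≤ ‖(gradient g (prodPt x (y + w))).snd - (gradient g (prodPt x y)).snd‖ := by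
  have h := (strong_mono g hg μg x hs y w).trans (real_inner_le_norm _ _)
  rcases (norm_nonneg w).eq_or_lt with h0 | h0
  · rw [← h0]; simp
  · exact le_of_mul_le_mul_right (by linarith [sq ‖w‖, mul_assoc μg ‖w‖ ‖w‖, congrArg (μg * ·) (sq ‖w‖)]) h0

lemma grad_zero (g : WithLp 2 (Euc d × Euc d') → ℝ) (hg : Differentiable ℝ g)
    (x : Euc d) (y : Euc d') (hmin : ∀ y', g (prodPt x y) ≤ g (prodPt x y')) :
    (gradient g (prodPt x y)).snd = 0 := by
  have h := line_deriv g hg x y ((gradient g (prodPt x y)).snd) 0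
  have hl : IsLocalMin (fun t : ℝ => g (prodPt x (y + t • (gradient g (prodPt x y)).snd))) 0 :=
    Filter.Eventually.of_forall fun t => by simpa using hmin _
  have := hl.hasDerivAt_eq_zero h
  simpa using this

lemma hess_lower (g : WithLp 2 (Euc d × Euc d') → ℝ) (hg : Differentiable ℝ g)
    (μg : ℝ) (x : Euc d)
    (hs : StrongConvexOn Set.univ μg (fun y : Euc d' => g (prodPt x y))) (y w : Euc d')
    (hG : DifferentiableAt ℝ (gradient g) (prodPt x y)) :
    μg * ‖w‖ ≤ ‖(fderiv ℝ (gradient g) (prodPt x y) (prodPt 0 w)).snd‖ := by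
  have hG' : HasFDerivAt (gradient g) (fderiv ℝ (gradient g) (prodPt x y))
      (prodPt x (y + (0 : ℝ) • w)) := by
    simpa using hG.hasFDerivAt
  have h2 := line_hasDerivAt _ _ x y w (0 : ℝ) ((sndL d d').hasFDerivAt.comp _ hG')
  have h3 := (hasDerivAt_iff_tendsto_slope.1 h2).norm
  refine ge_of_tendsto h3 ?_
  filter_upwards [self_mem_nhdsWithin] with t ht
  have ht' : t ≠ 0 := ht
  have h4 := strong_mono_norm g hg μg x hs y (t • w)
  rw [slope_def_module]
  simp only [Function.comp, sndL_apply, zero_smul, add_zero, sub_zero]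
  rw [norm_smul, norm_inv]
  rw [norm_smul] at h4
  have : 0 < ‖t‖ := norm_pos_iff.2 ht'
  rw [inv_mul_eq_div, le_div_iff₀ this]
  linarith

end helpers

theorem lower_level_solution_jacobian_lipschitz {d d' : ℕ}
    (g : WithLp 2 (Euc d × Euc d') → ℝ)
    (hg : ContDiff ℝ 2 g)
    (ℓg1 ℓg2 : ℝ)
    (hgradLip : ∀ p q : WithLp 2 (Euc d × Euc d'),
      ‖gradient g p - gradient g q‖ ≤ ℓg1 * ‖p - q‖)
    (hhessLip : ∀ p q : WithLp 2 (Euc d × Euc d'),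
      ‖fderiv ℝ (gradient g) p - fderiv ℝ (gradient g) q‖ ≤ ℓg2 * ‖p - q‖)
    (μg : ℝ) (hμg : 0 < μg)
    (hstrong : ∀ x : Euc d,
      StrongConvexOn Set.univ μg (fun y : Euc d' => g (prodPt x y)))
    (ystar : Euc d → Euc d')
    (hmin : ∀ (x : Euc d) (y : Euc d'), g (prodPt x (ystar x)) ≤ g (prodPt x y))
    (huniq : ∀ (x : Euc d) (y : Euc d'),
      (∀ y' : Euc d', g (prodPt x y) ≤ g (prodPt x y')) → y = ystar x) :
    ∀ x₁ x₂ : Euc d,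
      ‖fderiv ℝ ystar x₁ - fderiv ℝ ystar x₂‖
        ≤ ((ℓg2 + ℓg2 * (ℓg1 / μg)) / μg
            + ℓg1 * (ℓg2 + ℓg2 * (ℓg1 / μg)) / μg ^ 2) * ‖x₁ - x₂‖ := by
  intro x₁ x₂
  rcases eq_or_ne x₁ x₂ with rfl | hne
  · simp
  have hpos : 0 < ‖x₁ - x₂‖ := norm_pos_iff.2 (sub_ne_zero.2 hne)
  have hdg : Differentiable ℝ g := hg.differentiable (by norm_num)
  have hdG : Differentiable ℝ (gradient g) := by
    have h1 : ContDiff ℝ 1 (fderiv ℝ g) := hg.fderiv_right (by norm_num)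
    have h2 : Differentiable ℝ (fderiv ℝ g) := h1.differentiable (by norm_num)
    exact (InnerProductSpace.toDual ℝ
      (WithLp 2 (Euc d × Euc d'))).symm.toContinuousLinearEquiv.differentiable.comp h2
  have hP : 0 < ‖prodPt x₁ (0 : Euc d') - prodPt x₂ 0‖ := by
    rw [← prodPt_sub, sub_zero, norm_prodPt_zero_right]; exact hpos
  have hl1 : 0 ≤ ℓg1 := nonneg_of_mul_nonneg_left ((norm_nonneg _).trans (hgradLip _ _)) hP
  have hl2 : 0 ≤ ℓg2 := nonneg_of_mul_nonneg_left ((norm_nonneg _).trans (hhessLip _ _)) hP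
  have hz : ∀ x, (gradient g (prodPt x (ystar x))).snd = 0 := fun x =>
    grad_zero g hdg x _ (hmin x)
  -- Lipschitz continuity of the solution map
  have hyL : ∀ a b, μg * ‖ystar a - ystar b‖ ≤ ℓg1 * ‖a - b‖ := by
    intro a b
    have h := strong_mono_norm g hdg μg a (hstrong a) (ystar b) (ystar a - ystar b)
    rw [add_sub_cancel, hz a, ← hz b] at h
    refine h.trans ?_
    refine (norm_wsnd_le (gradient g (prodPt b (ystar b)) - gradient g (prodPt a (ystar b)))).trans ?_
    refine (hgradLip _ _).trans ?_
    rw [← prodPt_sub, sub_self, norm_prodPt_zero_right, norm_sub_rev]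
  have hyL' : ∀ a b, ‖ystar a - ystar b‖ ≤ ℓg1 / μg * ‖a - b‖ := by
    intro a b
    rw [div_mul_eq_mul_div, le_div_iff₀ hμg]
    linarith [hyL a b]
  have hpL : ∀ a b, ‖prodPt a (ystar a) - prodPt b (ystar b)‖ ≤ (1 + ℓg1 / μg) * ‖a - b‖ := by
    intro a b
    rw [← prodPt_sub]
    refine (norm_prodPt_le _ _).trans ?_
    linarith [hyL' a b]
  have hH : ∀ p v, ‖fderiv ℝ (gradient g) p v‖ ≤ ℓg1 * ‖v‖ := by
    intro p v
    have : ‖fderiv ℝ (gradient g) p‖ ≤ ℓg1 := by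
      refine (hdG p).hasFDerivAt.le_of_lip' hl1 (Filter.Eventually.of_forall fun q => hgradLip q p)
    exact (ContinuousLinearMap.le_opNorm _ _).trans (by gcongr)
  -- the derivative of the solution map
  have hJ : ∀ x, ∃ J : Euc d →L[ℝ] Euc d', HasFDerivAt ystar J x ∧
      ∀ v, (fderiv ℝ (gradient g) (prodPt x (ystar x)) (prodPt v (J v))).snd = 0 := by
    intro x
    set p := prodPt x (ystar x) with hp
    set H := fderiv ℝ (gradient g) p with hHdef
    set A : Euc d' →L[ℝ] Euc d' := (sndL d d').comp (H.comp (inrL d d')) with hA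
    set B : Euc d →L[ℝ] Euc d' := (sndL d d').comp (H.comp (inlL d d')) with hB
    have hAl : ∀ w, μg * ‖w‖ ≤ ‖A w‖ := fun w =>
      hess_lower g hdg μg x (hstrong x) (ystar x) w (hdG _)
    have hinj : Function.Injective (A : Euc d' →ₗ[ℝ] Euc d') := by
      refine (injective_iff_map_eq_zero _).2 fun w hw => ?_
      have h := hAl w
      have hw' : A w = 0 := hw
      rw [hw', norm_zero] at h
      have : ‖w‖ ≤ 0 := by
        by_contra hc
        push Not at hc
        nlinarith [mul_pos hμg hc]
      exact norm_le_zero_iff.1 this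
    have hsurj := LinearMap.surjective_of_injective hinj
    obtain ⟨R, hR⟩ := LinearMap.exists_rightInverse_of_surjective _ (LinearMap.range_eq_top.2 hsurj)
    have hR' : ∀ w, A (R w) = w := fun w => LinearMap.congr_fun hR w
    set J : Euc d →L[ℝ] Euc d' := -((LinearMap.toContinuousLinearMap R).comp B) with hJdef
    have hAJ : ∀ v, A (J v) = - B v := by
      intro v
      have : J v = - R (B v) := rfl
      rw [this, map_neg, hR']
    have hsplit : ∀ v w, (H (prodPt v w)).snd = B v + A w := by
      intro v w
      have : prodPt v w = prodPt v 0 + prodPt 0 w := by rw [← prodPt_add]; simp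
      rw [this, map_add]; rfl
    refine ⟨J, ?_, fun v => by rw [hsplit, hAJ, add_neg_cancel]⟩
    rw [hasFDerivAt_iff_isLittleO]
    have hcont : Filter.Tendsto (fun x' => prodPt x' (ystar x')) (nhds x) (nhds p) := by
      rw [tendsto_iff_norm_sub_tendsto_zero]
      refine squeeze_zero (fun _ => norm_nonneg _) (fun x' => hpL x' x) ?_
      have : Continuous fun x' : Euc d => (1 + ℓg1 / μg) * ‖x' - x‖ := by fun_prop
      simpa using this.tendsto x
    have h1 := (hasFDerivAt_iff_isLittleO.1 (hdG p).hasFDerivAt).comp_tendsto hcont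
    have h2 : (fun x' => prodPt x' (ystar x') - p) =O[nhds x] fun x' => x' - x :=
      Asymptotics.IsBigO.of_bound _ (Filter.Eventually.of_forall fun x' => hpL x' x)
    have h3 := h1.trans_isBigO h2
    refine Asymptotics.IsBigO.trans_isLittleO ?_ h3
    refine Asymptotics.IsBigO.of_bound (μg⁻¹) (Filter.Eventually.of_forall fun x' => ?_)
    rw [inv_mul_eq_div, le_div_iff₀ hμg, mul_comm]
    refine (hAl _).trans ?_
    refine le_trans (le_of_eq ?_) (norm_wsnd_le _)
    simp only [Function.comp]
    rw [← norm_neg]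
    congr 1
    have e : (gradient g (prodPt x' (ystar x')) - gradient g p
        - H (prodPt x' (ystar x') - p)).snd
        = (gradient g (prodPt x' (ystar x'))).snd - (gradient g p).snd
        - (H (prodPt x' (ystar x') - p)).snd := rfl
    rw [e, hz, hz, hp, ← prodPt_sub, hsplit, map_sub, hAJ]
    abel
  obtain ⟨J₁, hJ₁, hE₁⟩ := hJ x₁
  obtain ⟨J₂, hJ₂, hE₂⟩ := hJ x₂
  rw [hJ₁.fderiv, hJ₂.fderiv]
  have hLy : 0 ≤ ℓg1 / μg := by positivity
  refine ContinuousLinearMap.opNorm_le_bound _ (by positivity) fun v => ?_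
  have hJ2 : ‖J₂ v‖ ≤ ℓg1 / μg * ‖v‖ := by
    refine (ContinuousLinearMap.le_opNorm _ _).trans ?_
    gcongr
    exact hJ₂.le_of_lip' hLy (Filter.Eventually.of_forall fun q => hyL' q x₂)
  have h1 := hess_lower g hdg μg x₁ (hstrong x₁) (ystar x₁) ((J₁ - J₂) v) (hdG _)
  set H₁ := fderiv ℝ (gradient g) (prodPt x₁ (ystar x₁)) with hH₁
  set H₂ := fderiv ℝ (gradient g) (prodPt x₂ (ystar x₂)) with hH₂
  have e : (H₁ (prodPt 0 ((J₁ - J₂) v))).snd = ((H₂ - H₁) (prodPt v (J₂ v))).snd := by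
    have e1 : prodPt 0 ((J₁ - J₂) v) = prodPt v (J₁ v) - prodPt v (J₂ v) := by
      rw [← prodPt_sub]; simp
    rw [e1, map_sub, sub_apply]
    change (H₁ _).snd - (H₁ _).snd = (H₂ _).snd - (H₁ _).snd
    rw [hE₁, hE₂]
  rw [e] at h1
  have h2 : ‖((H₂ - H₁) (prodPt v (J₂ v))).snd‖
      ≤ (ℓg2 * ((1 + ℓg1 / μg) * ‖x₁ - x₂‖)) * ((1 + ℓg1 / μg) * ‖v‖) := by
    refine (norm_wsnd_le _).trans ((ContinuousLinearMap.le_opNorm _ _).trans ?_)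
    refine mul_le_mul ?_ ?_ (norm_nonneg _) (by positivity)
    · rw [norm_sub_rev]
      refine (hhessLip _ _).trans ?_
      gcongr
      exact hpL _ _
    · refine (norm_prodPt_le _ _).trans ?_
      linarith
  have h3 : ‖(J₁ - J₂) v‖
      ≤ ((ℓg2 * ((1 + ℓg1 / μg) * ‖x₁ - x₂‖)) * ((1 + ℓg1 / μg) * ‖v‖)) / μg := by
    rw [le_div_iff₀ hμg]; linarith
  refine h3.trans (le_of_eq ?_)
  field_simp
end
end

section
/- Let f, g : ℝ^d × ℝ^{d'} → ℝ be such that f is ℓ_{f,0}-Lipschitz continuous with ℓ_{f,1}-Lipschitz gradient, g is twice continuously differentiable with ℓ_{g,1}-Lipschitz gradient and ℓ_{g,2}-Lipschitz Hessian, and y ↦ g(x,y) is μ_g-strongly convex for every x with μ_g > 0 and minimizer y*(x). Define F(x) := f(x, y*(x)), L_f := ℓ_{f,1} + ℓ_{g,1}ℓ_{f,1}/μ_g + (ℓ_{f,0}/μ_g)(ℓ_{g,2} + ℓ_{g,1}ℓ_{g,2}/μ_g), and L_F := ℓ_{f,1} + ℓ_{g,1}(ℓ_{f,1} + L_f)/μ_g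 + (ℓ_{f,0}/μ_g)(ℓ_{g,2} + ℓ_{g,1}ℓ_{g,2}/μ_g). Then ∇F is L_F-Lipschitz continuous: ‖∇F(x₁) − ∇F(x₂)‖ ≤ L_F ‖x₁ − x₂‖ for all x₁, x₂ ∈ ℝ^d. -/
open scoped InnerProductSpace

noncomputable section

section Aux

open Filter Topology

variable {X Y Z : Type*} [NormedAddCommGroup X] [InnerProductSpace ℝ X] [FiniteDimensional ℝ X]
  [NormedAddCommGroup Y] [InnerProductSpace ℝ Y] [FiniteDimensional ℝ Y]
  [NormedAddCommGroup Z] [InnerProductSpace ℝ Z] [FiniteDimensional ℝ Z]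

theorem aux_first_order {m : ℝ} {φ : Y → ℝ} (hφ : StrongConvexOn Set.univ m φ)
    {φ' : Y →L[ℝ] ℝ} {y : Y} (hd : HasFDerivAt φ φ' y) (z : Y) :
    φ' (z - y) + m / 2 * ‖z - y‖ ^ 2 ≤ φ z - φ y := by
  have hlin : HasDerivAt (fun t : ℝ => y + t • (z - y)) (z - y) 0 := by
    have := ((hasDerivAt_id (0 : ℝ)).smul_const (z - y)).const_add y
    simpa using this
  have hd' : HasFDerivAt φ φ' (y + (0 : ℝ) • (z - y)) := by simpa using hd
  have h1 : HasDerivAt (fun t : ℝ => φ (y + t • (z - y))) (φ' (z - y)) 0 :=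
    hd'.comp_hasDerivAt (0 : ℝ) hlin
  have h2 := h1.tendsto_slope_zero_right
  have h3 : Tendsto (fun t : ℝ => φ z - φ y - (1 - t) * (m / 2 * ‖z - y‖ ^ 2)) (𝓝[>] 0)
      (𝓝 (φ z - φ y - (1 - 0) * (m / 2 * ‖z - y‖ ^ 2))) := by
    apply Tendsto.mono_left _ nhdsWithin_le_nhds
    apply Continuous.tendsto
    fun_prop
  have h4 := le_of_tendsto_of_tendsto h2 h3 ?_
  · linarith
  · have : Set.Ioo (0 : ℝ) 1 ∈ 𝓝[>] (0 : ℝ) := Ioo_mem_nhdsGT one_pos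
    filter_upwards [this] with t ht
    obtain ⟨ht0, ht1⟩ := ht
    have h5 := hφ.2 (Set.mem_univ y) (Set.mem_univ z) (sub_nonneg.2 ht1.le)
      ht0.le (sub_add_cancel 1 t)
    have e : (1 - t) • y + t • z = y + t • (z - y) := by
      rw [sub_smul, smul_sub, one_smul]; abel
    rw [e, norm_sub_rev y z] at h5
    simp only [smul_eq_mul, zero_add, zero_smul, add_zero] at h5 ⊢
    rw [inv_mul_le_iff₀ ht0]
    nlinarith

theorem aux_mono {m : ℝ} {φ : Y → ℝ} (hφ : StrongConvexOn Set.univ m φ)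
    {φ' : Y → Y →L[ℝ] ℝ} (hd : ∀ y, HasFDerivAt φ (φ' y) y) (y z : Y) :
    m * ‖z - y‖ ^ 2 ≤ φ' z (z - y) - φ' y (z - y) := by
  have h1 := aux_first_order hφ (hd y) z
  have h2 := aux_first_order hφ (hd z) y
  rw [← neg_sub z y, map_neg, norm_neg] at h2
  linarith

theorem aux_coercive {m : ℝ} {G : Y → Y} {G' : Y →L[ℝ] Y} {y : Y} (hG : HasFDerivAt G G' y)
    (hm : ∀ z, m * ‖z - y‖ ^ 2 ≤ inner ℝ (G z - G y) (z - y)) (v : Y) :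
    m * ‖v‖ ^ 2 ≤ inner ℝ (G' v) v := by
  have hlin : HasDerivAt (fun t : ℝ => y + t • v) v 0 := by
    have := ((hasDerivAt_id (0 : ℝ)).smul_const v).const_add y
    simpa using this
  have hd' : HasFDerivAt G G' (y + (0 : ℝ) • v) := by simpa using hG
  have h1 : HasDerivAt (fun t : ℝ => G (y + t • v)) (G' v) 0 :=
    hd'.comp_hasDerivAt (0 : ℝ) hlin
  have h2 := h1.tendsto_slope_zero_right
  have h3 := Filter.Tendsto.inner h2 (tendsto_const_nhds (x := v)) (𝕜 := ℝ)
  refine ge_of_tendsto h3 ?_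
  filter_upwards [self_mem_nhdsWithin] with t ht
  have ht0 : (0 : ℝ) < t := ht
  have h4 := hm (y + t • v)
  simp only [add_sub_cancel_left, norm_smul, inner_smul_right, Real.norm_eq_abs, mul_pow,
    sq_abs] at h4
  simp only [zero_add, zero_smul, add_zero, real_inner_smul_left]
  rw [le_inv_mul_iff₀ ht0]
  have : t * (t * (m * ‖v‖ ^ 2)) ≤ t * inner ℝ (G (y + t • v) - G y) v := by linarith
  exact le_of_mul_le_mul_left this ht0

theorem aux_bound {m : ℝ} (hm : 0 < m) {B : Y →L[ℝ] Y}
    (hB : ∀ v, m * ‖v‖ ^ 2 ≤ inner ℝ (B v) v) (v : Y) : m * ‖v‖ ≤ ‖B v‖ := by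
  rcases (norm_nonneg v).eq_or_lt with h | h
  · rw [← h]; simp
  · have h1 := (hB v).trans (real_inner_le_norm _ _)
    refine le_of_mul_le_mul_right ?_ h
    nlinarith

theorem aux_inv {m : ℝ} (hm : 0 < m) {B : Y →L[ℝ] Y}
    (hB : ∀ v, m * ‖v‖ ≤ ‖B v‖) : ∃ C : Y →L[ℝ] Y, ∀ w, B (C w) = w := by
  have hinj : Function.Injective (B : Y →ₗ[ℝ] Y) := by
    rw [injective_iff_map_eq_zero]
    intro a ha
    have h1 := hB a
    have ha' : B a = 0 := ha
    rw [ha', norm_zero] at h1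
    have : ‖a‖ ≤ 0 := by
      by_contra h
      push Not at h
      nlinarith [mul_pos hm h]
    simpa using this
  have hs := LinearMap.injective_iff_surjective.1 hinj
  obtain ⟨C, hC⟩ := LinearMap.exists_rightInverse_of_surjective _ (LinearMap.range_eq_top.2 hs)
  exact ⟨LinearMap.toContinuousLinearMap C, fun w => LinearMap.congr_fun hC w⟩

theorem aux_main (I : X →L[ℝ] Z) (J : Y →L[ℝ] Z)
    (hI : ∀ v, ‖I v‖ = ‖v‖) (hJ : ∀ v, ‖J v‖ = ‖v‖)
    (f g : Z → ℝ) (a b c e : ℝ) (ha : 0 ≤ a) (hb : 0 ≤ b) (hc : 0 ≤ c) (he : 0 ≤ e)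
    (hfLip : ∀ p q, |f p - f q| ≤ a * ‖p - q‖)
    (hfdiff : Differentiable ℝ f)
    (hfgradLip : ∀ p q, ‖gradient f p - gradient f q‖ ≤ b * ‖p - q‖)
    (hg : ContDiff ℝ 2 g)
    (hggradLip : ∀ p q, ‖gradient g p - gradient g q‖ ≤ c * ‖p - q‖)
    (hghessLip : ∀ p q, ‖fderiv ℝ (gradient g) p - fderiv ℝ (gradient g) q‖ ≤ e * ‖p - q‖)
    (m : ℝ) (hm : 0 < m)
    (hstrong : ∀ x, StrongConvexOn Set.univ m (fun y => g (I x + J y)))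
    (ys : X → Y)
    (hmin : ∀ x y, g (I x + J (ys x)) ≤ g (I x + J y)) (x₁ x₂ : X) :
    ‖gradient (fun x => f (I x + J (ys x))) x₁ - gradient (fun x => f (I x + J (ys x))) x₂‖
      ≤ (1 + c / m) ^ 2 * (b + a * e / m) * ‖x₁ - x₂‖ := by
  have hgd : Differentiable ℝ g := hg.differentiable (by norm_num)
  have hGd : Differentiable ℝ (gradient g) := by
    have h1 : Differentiable ℝ (fderiv ℝ g) :=
      (hg.fderiv_right (m := 1) (by norm_num)).differentiable (by norm_num)
    exact (InnerProductSpace.toDual ℝ Z).symm.differentiable.comp h1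
  have hin : ∀ p z, fderiv ℝ g p z = inner ℝ (gradient g p) z := fun p z => by
    rw [inner_gradient_left]
  have hinf : ∀ p z, fderiv ℝ f p z = inner ℝ (gradient f p) z := fun p z => by
    rw [inner_gradient_left]
  set K : Z →L[ℝ] Y := ContinuousLinearMap.adjoint J with hK
  have hKn : ∀ z, ‖K z‖ ≤ ‖z‖ := by
    intro z
    have h1 : ‖K‖ ≤ 1 := by
      rw [hK, LinearIsometryEquiv.norm_map]
      exact J.opNorm_le_bound zero_le_one (fun v => by rw [hJ, one_mul])
    calc ‖K z‖ ≤ ‖K‖ * ‖z‖ := K.le_opNorm z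
      _ ≤ 1 * ‖z‖ := by gcongr
      _ = ‖z‖ := one_mul _
  have hKin : ∀ z w, inner ℝ (K z) w = inner ℝ z (J w) := fun z w =>
    ContinuousLinearMap.adjoint_inner_left J w z
  -- partial derivatives
  have hJd : ∀ x y, HasFDerivAt (fun y => I x + J y) J y := fun x y =>
    (J.hasFDerivAt).const_add (I x)
  have hpd : ∀ x y, HasFDerivAt (fun y => g (I x + J y))
      ((fderiv ℝ g (I x + J y)).comp J) y := fun x y =>
    (hgd (I x + J y)).hasFDerivAt.comp y (hJd x y)
  have hmono : ∀ x y z, m * ‖z - y‖ ^ 2 ≤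
      inner ℝ (K (gradient g (I x + J z)) - K (gradient g (I x + J y))) (z - y) := by
    intro x y z
    have h := aux_mono (hstrong x) (hpd x) y z
    rw [inner_sub_left, hKin, hKin, ← hin, ← hin]
    exact h
  have hzero : ∀ x, K (gradient g (I x + J (ys x))) = 0 := by
    intro x
    have h1 : IsLocalMin (fun y => g (I x + J y)) (ys x) :=
      Filter.Eventually.of_forall (fun y => hmin x y)
    have h2 := h1.hasFDerivAt_eq_zero (hpd x (ys x))
    refine ext_inner_right ℝ (fun w => ?_)
    rw [hKin, ← hin, inner_zero_left]
    exact DFunLike.congr_fun h2 w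
  set P : X → Z := fun x => I x + J (ys x) with hP
  set H : Z → Z →L[ℝ] Z := fun p => fderiv ℝ (gradient g) p with hH
  have hHn : ∀ p z, ‖H p z‖ ≤ c * ‖z‖ := by
    intro p z
    have h1 : ‖H p‖ ≤ c := by
      refine (hGd p).hasFDerivAt.le_of_lip' hc ?_
      exact Filter.Eventually.of_forall (fun q => hggradLip q p)
    exact (H p).le_of_opNorm_le h1 z
  -- coercivity
  have hco : ∀ x y v, m * ‖v‖ ≤ ‖K (H (I x + J y) (J v))‖ := by
    intro x y v
    have h1 : HasFDerivAt (fun y => K (gradient g (I x + J y)))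
        (K.comp ((H (I x + J y)).comp J)) y := by
      have h0 : HasFDerivAt (fun y => gradient g (I x + J y)) ((H (I x + J y)).comp J) y :=
        HasFDerivAt.comp (g := gradient g) y (hGd (I x + J y)).hasFDerivAt (hJd x y)
      exact K.hasFDerivAt.comp y h0
    exact aux_bound hm (aux_coercive h1 (fun z => hmono x y z)) v
  have hTex : ∀ x, ∃ T : X →L[ℝ] Y, ∀ v, K (H (P x) (I v + J (T v))) = 0 := by
    intro x
    obtain ⟨C, hC⟩ := aux_inv hm (B := K.comp ((H (P x)).comp J)) (fun v => hco x (ys x) v)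
    refine ⟨-(C.comp (K.comp ((H (P x)).comp I))), fun v => ?_⟩
    have h := hC (K (H (P x) (I v)))
    simp only [ContinuousLinearMap.comp_apply] at h
    simp only [ContinuousLinearMap.neg_apply, ContinuousLinearMap.comp_apply, map_add, map_neg, h,
      add_neg_cancel]
  choose T hT using hTex
  have hcm : 0 ≤ c / m := by positivity
  have hTn : ∀ x v, ‖T x v‖ ≤ c / m * ‖v‖ := by
    intro x v
    have h1 := hco x (ys x) (T x v)
    have h2 : K (H (P x) (J (T x v))) = - K (H (P x) (I v)) := by
      have := hT x v
      rw [map_add, map_add] at this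
      exact eq_neg_of_add_eq_zero_right this
    have h3 : ‖K (H (P x) (J (T x v)))‖ ≤ c * ‖v‖ := by
      rw [h2, norm_neg, ← hI v]
      exact (hKn _).trans (hHn _ _)
    rw [div_mul_eq_mul_div, le_div_iff₀ hm]
    linarith [h1.trans h3]
  have hAn : ∀ x v, ‖I v + J (T x v)‖ ≤ (1 + c / m) * ‖v‖ := by
    intro x v
    have := norm_add_le (I v) (J (T x v))
    rw [hI, hJ] at this
    linarith [hTn x v]
  -- Lipschitz ys
  have hys : ∀ x z, ‖ys x - ys z‖ ≤ c / m * ‖x - z‖ := by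
    intro x z
    have h1 := hmono x (ys z) (ys x)
    rw [hzero x, ← hzero z, ← map_sub] at h1
    have h2 : ‖K (gradient g (I z + J (ys z)) - gradient g (I x + J (ys z)))‖ ≤ c * ‖x - z‖ := by
      refine (hKn _).trans ((hggradLip _ _).trans ?_)
      rw [add_sub_add_right_eq_sub, ← map_sub, hI, norm_sub_rev]
    have h3 := h1.trans (real_inner_le_norm _ _)
    rw [div_mul_eq_mul_div, le_div_iff₀ hm]
    rcases (norm_nonneg (ys x - ys z)).eq_or_lt with h | h
    · rw [← h, zero_mul]; positivity
    · refine le_of_mul_le_mul_right ?_ h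
      have := mul_le_mul_of_nonneg_right h2 h.le
      nlinarith
  have hPl : ∀ x z, ‖P x - P z‖ ≤ (1 + c / m) * ‖x - z‖ := by
    intro x z
    have e1 : P x - P z = I (x - z) + J (ys x - ys z) := by
      simp only [hP, map_sub]; abel
    have := norm_add_le (I (x - z)) (J (ys x - ys z))
    rw [hI, hJ] at this
    rw [e1]
    linarith [hys x z]
  -- derivative of ys
  have hyd : ∀ x, HasFDerivAt ys (T x) x := by
    intro x
    have h1 : HasFDerivAt (fun p => K (gradient g p)) (K.comp (H (P x))) (P x) :=
      K.hasFDerivAt.comp (P x) (hGd (P x)).hasFDerivAt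
    have hPO : (fun z => P z - P x) =O[𝓝 x] (fun z => z - x) :=
      Asymptotics.IsBigO.of_bound _ (Filter.Eventually.of_forall (fun z => hPl z x))
    have hPc : Tendsto P (𝓝 x) (𝓝 (P x)) := by
      rw [tendsto_iff_norm_sub_tendsto_zero]
      have h0 : Tendsto (fun z => (1 + c / m) * ‖z - x‖) (𝓝 x) (𝓝 ((1 + c / m) * ‖x - x‖)) := by
        apply Continuous.tendsto; fun_prop
      rw [sub_self, norm_zero, mul_zero] at h0
      exact squeeze_zero (fun _ => norm_nonneg _) (fun z => hPl z x) h0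
    have h2 := (h1.isLittleO.comp_tendsto hPc).trans_isBigO hPO
    refine HasFDerivAt.of_isLittleO ?_
    refine Asymptotics.IsBigO.trans_isLittleO ?_ h2
    refine Asymptotics.IsBigO.of_bound m⁻¹ (Filter.Eventually.of_forall (fun z => ?_))
    simp only [Function.comp_apply]
    rw [hzero z, hzero x, sub_self, zero_sub, norm_neg, le_inv_mul_iff₀ hm]
    have h3 := hco x (ys x) (ys z - ys x - T x (z - x))
    have h4 : (K.comp (H (P x))) (P z - P x)
        = K (H (P x) (J (ys z - ys x - T x (z - x)))) := by
      have h5 : P z - P x = (I (z - x) + J (T x (z - x))) + J (ys z - ys x - T x (z - x)) := by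
        simp only [hP, map_sub]; abel
      rw [ContinuousLinearMap.comp_apply, h5, map_add, map_add, hT, zero_add]
    rw [h4]; exact h3
  have hFd : ∀ x, HasFDerivAt (fun x => f (I x + J (ys x)))
      ((fderiv ℝ f (P x)).comp (I + J.comp (T x))) x := fun x =>
    (hfdiff (P x)).hasFDerivAt.comp x (I.hasFDerivAt.add (J.hasFDerivAt.comp x (hyd x)))
  have hfn : ∀ p, ‖gradient f p‖ ≤ a := by
    intro p
    unfold gradient
    rw [LinearIsometryEquiv.norm_map]
    exact (hfdiff p).hasFDerivAt.le_of_lip' ha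
      (Filter.Eventually.of_forall (fun q => hfLip q p))
  have hgr : ∀ x, gradient (fun x => f (I x + J (ys x))) x
      = (InnerProductSpace.toDual ℝ X).symm ((fderiv ℝ f (P x)).comp (I + J.comp (T x))) :=
    fun x => by
      unfold gradient
      rw [(hFd x).fderiv]
  rw [hgr, hgr, ← map_sub, LinearIsometryEquiv.norm_map]
  refine ContinuousLinearMap.opNorm_le_bound _ (by positivity) (fun v => ?_)
  have hΔ : ‖T x₁ v - T x₂ v‖ ≤ e / m * (1 + c / m) * ‖P x₁ - P x₂‖ * ‖v‖ := by
    have h1 := hco x₁ (ys x₁) (T x₁ v - T x₂ v)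
    have h2 : K (H (P x₁) (J (T x₁ v - T x₂ v)))
        = - K ((H (P x₁) - H (P x₂)) (I v + J (T x₂ v))) := by
      have h3 : J (T x₁ v - T x₂ v) = (I v + J (T x₁ v)) - (I v + J (T x₂ v)) := by
        rw [map_sub]; abel
      rw [h3, map_sub, map_sub, hT, ContinuousLinearMap.sub_apply, map_sub, hT]
      abel
    have h4 : ‖K (H (P x₁) (J (T x₁ v - T x₂ v)))‖
        ≤ (e * ‖P x₁ - P x₂‖) * ((1 + c / m) * ‖v‖) := by
      rw [h2, norm_neg]
      refine (hKn _).trans ?_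
      refine ((H (P x₁) - H (P x₂)).le_of_opNorm_le (hghessLip _ _) _).trans ?_
      gcongr
      exact hAn _ _
    have h5 := h1.trans h4
    have h6 : ‖T x₁ v - T x₂ v‖ ≤ (e * ‖P x₁ - P x₂‖) * ((1 + c / m) * ‖v‖) / m := by
      rw [le_div_iff₀ hm]; linarith
    refine h6.trans (le_of_eq ?_)
    ring
  have hsplit : ((fderiv ℝ f (P x₁)).comp (I + J.comp (T x₁))
        - (fderiv ℝ f (P x₂)).comp (I + J.comp (T x₂))) v
      = inner ℝ (gradient f (P x₁) - gradient f (P x₂)) (I v + J (T x₁ v))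
        + inner ℝ (gradient f (P x₂)) (J (T x₁ v - T x₂ v)) := by
    simp only [ContinuousLinearMap.sub_apply, ContinuousLinearMap.comp_apply,
      ContinuousLinearMap.add_apply, hinf, inner_sub_left, map_sub, inner_sub_right,
      inner_add_right]
    ring
  rw [hsplit]
  have hA : ‖inner ℝ (gradient f (P x₁) - gradient f (P x₂)) (I v + J (T x₁ v))‖
      ≤ (b * ‖P x₁ - P x₂‖) * ((1 + c / m) * ‖v‖) := by
    refine (norm_inner_le_norm _ _).trans ?_
    gcongr
    · exact hfgradLip _ _
    · exact hAn _ _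
  have hB : ‖inner ℝ (gradient f (P x₂)) (J (T x₁ v - T x₂ v))‖
      ≤ a * (e / m * (1 + c / m) * ‖P x₁ - P x₂‖ * ‖v‖) := by
    refine (norm_inner_le_norm _ _).trans ?_
    rw [hJ]
    gcongr
    exact hfn _
  refine (norm_add_le _ _).trans ((add_le_add hA hB).trans ?_)
  calc b * ‖P x₁ - P x₂‖ * ((1 + c / m) * ‖v‖)
        + a * (e / m * (1 + c / m) * ‖P x₁ - P x₂‖ * ‖v‖)
      = ((1 + c / m) * (b + a * e / m) * ‖v‖) * ‖P x₁ - P x₂‖ := by ring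
    _ ≤ ((1 + c / m) * (b + a * e / m) * ‖v‖) * ((1 + c / m) * ‖x₁ - x₂‖) := by
        gcongr
        exact hPl _ _
    _ = _ := by ring

end Aux

theorem upper_level_gradient_lipschitz {d d' : ℕ}
    (f g : WithLp 2 (Euc d × Euc d') → ℝ)
    (ℓf0 ℓf1 ℓg1 ℓg2 : ℝ)
    (hfLip : ∀ p q : WithLp 2 (Euc d × Euc d'), |f p - f q| ≤ ℓf0 * ‖p - q‖)
    (hfdiff : Differentiable ℝ f)
    (hfgradLip : ∀ p q : WithLp 2 (Euc d × Euc d'),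
      ‖gradient f p - gradient f q‖ ≤ ℓf1 * ‖p - q‖)
    (hg : ContDiff ℝ 2 g)
    (hggradLip : ∀ p q : WithLp 2 (Euc d × Euc d'),
      ‖gradient g p - gradient g q‖ ≤ ℓg1 * ‖p - q‖)
    (hghessLip : ∀ p q : WithLp 2 (Euc d × Euc d'),
      ‖fderiv ℝ (gradient g) p - fderiv ℝ (gradient g) q‖ ≤ ℓg2 * ‖p - q‖)
    (μg : ℝ) (hμg : 0 < μg)
    (hstrong : ∀ x : Euc d,
      StrongConvexOn Set.univ μg (fun y : Euc d' => g (prodPt x y)))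
    (ystar : Euc d → Euc d')
    (hmin : ∀ (x : Euc d) (y : Euc d'), g (prodPt x (ystar x)) ≤ g (prodPt x y))
    (huniq : ∀ (x : Euc d) (y : Euc d'),
      (∀ y' : Euc d', g (prodPt x y) ≤ g (prodPt x y')) → y = ystar x) :
    ∀ x₁ x₂ : Euc d,
      ‖gradient (fun x : Euc d => f (prodPt x (ystar x))) x₁
          - gradient (fun x : Euc d => f (prodPt x (ystar x))) x₂‖
        ≤ (ℓf1
            + ℓg1 * (ℓf1 + (ℓf1 + ℓg1 * ℓf1 / μg + (ℓf0 / μg) * (ℓg2 + ℓg1 * ℓg2 / μg))) / μg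
            + (ℓf0 / μg) * (ℓg2 + ℓg1 * ℓg2 / μg)) * ‖x₁ - x₂‖ := by
  intro x₁ x₂
  by_cases hx : x₁ = x₂
  · subst hx; simp
  have hpos : 0 < ‖prodPt x₁ (0 : Euc d') - prodPt x₂ (0 : Euc d')‖ := by
    rw [norm_pos_iff, sub_ne_zero]
    intro h
    exact hx (congrArg Prod.fst ((WithLp.equiv 2 (Euc d × Euc d')).symm.injective h))
  have ha : 0 ≤ ℓf0 := nonneg_of_mul_nonneg_left ((abs_nonneg _).trans (hfLip _ _)) hpos
  have hb : 0 ≤ ℓf1 := nonneg_of_mul_nonneg_left ((norm_nonneg _).trans (hfgradLip _ _)) hpos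
  have hc : 0 ≤ ℓg1 := nonneg_of_mul_nonneg_left ((norm_nonneg _).trans (hggradLip _ _)) hpos
  have he : 0 ≤ ℓg2 := nonneg_of_mul_nonneg_left ((norm_nonneg _).trans (hghessLip _ _)) hpos
  let Q : (Euc d × Euc d') →L[ℝ] WithLp 2 (Euc d × Euc d') :=
    ((WithLp.prodContinuousLinearEquiv 2 ℝ (Euc d) (Euc d')).symm :
      (Euc d × Euc d') →L[ℝ] WithLp 2 (Euc d × Euc d'))
  let I : Euc d →L[ℝ] WithLp 2 (Euc d × Euc d') := Q.comp (ContinuousLinearMap.inl ℝ _ _)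
  let J : Euc d' →L[ℝ] WithLp 2 (Euc d × Euc d') := Q.comp (ContinuousLinearMap.inr ℝ _ _)
  have hI : ∀ v, ‖I v‖ = ‖v‖ := fun v => WithLp.norm_toLp_fst 2 (Euc d) (Euc d') v
  have hJ : ∀ v, ‖J v‖ = ‖v‖ := fun v => WithLp.norm_toLp_snd 2 (Euc d) (Euc d') v
  have hIJ : ∀ x y, prodPt x y = I x + J y := by
    intro x y
    have h : I x + J y = Q (x, y) := by
      change Q (x, 0) + Q (0, y) = Q (x, y)
      rw [← map_add]; simp
    rw [h]; rfl
  simp only [hIJ] at hstrong hmin ⊢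
  refine (aux_main I J hI hJ f g ℓf0 ℓf1 ℓg1 ℓg2 ha hb hc he hfLip hfdiff hfgradLip hg hggradLip
    hghessLip μg hμg hstrong ystar hmin x₁ x₂).trans (le_of_eq ?_)
  ring
end
end
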